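/- arXiv:2005.12431 — 2 statements merged into one kernel-verified Lean document; each statement's English description precedes it below -/
import Mathlib

section
/- Let ε₀ > 0 be sufficiently small and let h be a polynomial satisfying the coefficient smallness condition. Then for every point ζ ∈ [-1,1]², the translated polynomial (h∘T_{ζ,1}^{-1})(ξ,η) = Σ_{i=0}^{d} Σ_{j=0}^{i} a'_{i,j} ξ^{i−j} η^{j} (where T_{ζ,1} is the translation sending ζ to the origin) satisfies |a'_{2,0}| + |a'_{2,2}| ≤ Cε₀ and |a'_{2,1} − 1| ≤ Cε₀ for a constant C depending only on d, and moreover there exists an invertible affine transformation T_{ζ,2} of ℝ², which is a perturbation of the identity of size O(ε₀), such that writing (h∘T_{ζ,1}^{-1}∘T_{ζ,2}^{-1})(ξ,η) = Σ_{i=0}^{d} Σ_{j=0}^{i} a''_{i,j} ξ^{i−j} η^{j}, one has a''_{2,1} = 1 and a''_{2,0} = a''_{2,2} = 0; in other words, the quadratic part of h composed with the inverse of T_ζ := T_{ζ,2}∘T_{ζ,1} is exactly ξη. -/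
noncomputable section

/-- The square `[-1,1]²`. -/
def unitSq : Set (ℝ × ℝ) := Set.Icc (-1 : ℝ) 1 ×ˢ Set.Icc (-1 : ℝ) 1

/-- The polynomial `h(ξ,η) = ξη + a₂₀ξ² + a₂₂η² + Σ_{i=3}^d Σ_{j=0}^i a_{i,j} ξ^{i-j} η^j`. -/
def hpoly (d : ℕ) (a : ℕ → ℕ → ℝ) (ξ η : ℝ) : ℝ :=
  ξ * η + a 2 0 * ξ ^ 2 + a 2 2 * η ^ 2 +
    ∑ i ∈ Finset.Icc 3 d, ∑ j ∈ Finset.range (i + 1), a i j * ξ ^ (i - j) * η ^ j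

/-- Coefficient smallness condition. -/
def CoeffSmall (d : ℕ) (ε₀ : ℝ) (a : ℕ → ℕ → ℝ) : Prop :=
  |a 2 0| + |a 2 2| +
      100 ^ d * ∑ i ∈ Finset.Icc 3 d, ∑ j ∈ Finset.range (i + 1), |a i j| ≤ ε₀

/-- The polynomial `Σ_{i=0}^n Σ_{j=0}^i c_{i,j} ξ^{i-j} η^j`. -/
def polyEval (n : ℕ) (c : ℕ → ℕ → ℝ) (ξ η : ℝ) : ℝ :=
  ∑ i ∈ Finset.range (n + 1), ∑ j ∈ Finset.range (i + 1), c i j * ξ ^ (i - j) * η ^ j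

/-- The coefficients of `ξ` times the polynomial with coefficients `c`. -/
def mulFstCoeff (c : ℕ → ℕ → ℝ) : ℕ → ℕ → ℝ
  | 0, _ => 0
  | i + 1, j => if j ≤ i then c i j else 0

/-- The coefficients of `η` times the polynomial with coefficients `c`. -/
def mulSndCoeff (c : ℕ → ℕ → ℝ) : ℕ → ℕ → ℝ
  | 0, _ => 0
  | _ + 1, 0 => 0
  | i + 1, j + 1 => c i j

lemma polyEval_mulFstCoeff (n : ℕ) (c : ℕ → ℕ → ℝ) (ξ η : ℝ) :
    polyEval (n + 1) (mulFstCoeff c) ξ η = ξ * polyEval n c ξ η := by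
  unfold polyEval
  rw [Finset.sum_range_succ', Finset.mul_sum]
  simp only [mulFstCoeff, zero_add, Finset.range_one, Finset.sum_singleton, zero_mul, add_zero]
  refine Finset.sum_congr rfl fun i _ => ?_
  rw [Finset.sum_range_succ, Finset.mul_sum]
  simp only [show ¬ i + 1 ≤ i by omega, if_false, zero_mul, add_zero]
  refine Finset.sum_congr rfl fun j hj => ?_
  have hj' : j ≤ i := by simpa [Nat.lt_succ_iff] using hj
  rw [if_pos hj', show i + 1 - j = (i - j) + 1 by omega]
  ring

lemma polyEval_mulSndCoeff (n : ℕ) (c : ℕ → ℕ → ℝ) (ξ η : ℝ) :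
    polyEval (n + 1) (mulSndCoeff c) ξ η = η * polyEval n c ξ η := by
  unfold polyEval
  rw [Finset.sum_range_succ', Finset.mul_sum]
  simp only [mulSndCoeff, zero_add, Finset.range_one, Finset.sum_singleton, zero_mul, add_zero]
  refine Finset.sum_congr rfl fun i _ => ?_
  rw [Finset.sum_range_succ', Finset.mul_sum]
  simp only [zero_mul, add_zero, Nat.add_sub_add_right]
  refine Finset.sum_congr rfl fun j _ => ?_
  ring

lemma abs_mulFstCoeff (c : ℕ → ℕ → ℝ) (i j : ℕ) :
    |mulFstCoeff c i j| = mulFstCoeff (fun i j => |c i j|) i j := by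
  rcases i with _ | i
  · simp [mulFstCoeff]
  · by_cases h : j ≤ i <;> simp [mulFstCoeff, h]

lemma abs_mulSndCoeff (c : ℕ → ℕ → ℝ) (i j : ℕ) :
    |mulSndCoeff c i j| = mulSndCoeff (fun i j => |c i j|) i j := by
  rcases i with _ | i <;> rcases j with _ | j <;> simp [mulSndCoeff]

/-- `f` is a polynomial of degree at most `n` whose coefficients have absolute sum at most `M`. -/
def PolyBound (n : ℕ) (M : ℝ) (f : ℝ → ℝ → ℝ) : Prop :=
  ∃ c : ℕ → ℕ → ℝ, (∀ ξ η, f ξ η = polyEval n c ξ η) ∧ polyEval n (fun i j => |c i j|) 1 1 ≤ M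

namespace PolyBound

variable {n m : ℕ} {M N : ℝ} {f g : ℝ → ℝ → ℝ}

lemma one : PolyBound 0 1 fun _ _ => 1 :=
  ⟨fun _ _ => 1, by simp [polyEval], by simp [polyEval]⟩

lemma zero (n : ℕ) : PolyBound n 0 fun _ _ => 0 :=
  ⟨fun _ _ => 0, by simp [polyEval], by simp [polyEval]⟩

lemma add (hf : PolyBound n M f) (hg : PolyBound n N g) :
    PolyBound n (M + N) fun ξ η => f ξ η + g ξ η := by
  obtain ⟨c, hc, hcM⟩ := hf
  obtain ⟨e, he, heN⟩ := hg
  refine ⟨fun i j => c i j + e i j, fun ξ η => ?_, ?_⟩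
  · simp only [hc, he, polyEval, add_mul, Finset.sum_add_distrib]
  · refine le_trans ?_ (add_le_add hcM heN)
    simp only [polyEval, one_pow, mul_one, ← Finset.sum_add_distrib]
    gcongr
    exact abs_add_le _ _

lemma const_mul (hf : PolyBound n M f) (r : ℝ) :
    PolyBound n (|r| * M) fun ξ η => r * f ξ η := by
  obtain ⟨c, hc, hcM⟩ := hf
  refine ⟨fun i j => r * c i j, fun ξ η => ?_, ?_⟩
  · simp only [hc, polyEval, Finset.mul_sum, mul_assoc]
  · refine le_trans (le_of_eq ?_) (mul_le_mul_of_nonneg_left hcM (abs_nonneg r))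
    simp only [polyEval, one_pow, mul_one, Finset.mul_sum, abs_mul]

lemma mono_degree (hf : PolyBound n M f) (h : n ≤ m) : PolyBound m M f := by
  obtain ⟨c, hc, hcM⟩ := hf
  have key : ∀ (e : ℕ → ℕ → ℝ) (ξ η : ℝ),
      polyEval m (fun i j => if i ≤ n then e i j else 0) ξ η = polyEval n e ξ η := by
    intro e ξ η
    unfold polyEval
    rw [← Finset.sum_subset (Finset.range_mono (show n + 1 ≤ m + 1 by omega))]
    · refine Finset.sum_congr rfl fun i hi => ?_
      have : i ≤ n := by simpa [Nat.lt_succ_iff] using hi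
      simp [this]
    · intro i _ hi
      have : ¬ i ≤ n := by simpa [Nat.lt_succ_iff] using hi
      simp [this]
  refine ⟨fun i j => if i ≤ n then c i j else 0, fun ξ η => by rw [hc, key], ?_⟩
  rw [← key] at hcM
  simpa [apply_ite abs] using hcM

lemma mono_bound (hf : PolyBound n M f) (h : M ≤ N) : PolyBound n N f := by
  obtain ⟨c, hc, hcM⟩ := hf
  exact ⟨c, hc, hcM.trans h⟩

lemma nonneg (hf : PolyBound n M f) : 0 ≤ M := by
  obtain ⟨c, -, hcM⟩ := hf
  refine le_trans ?_ hcM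
  unfold polyEval
  positivity

lemma fst_mul (hf : PolyBound n M f) : PolyBound (n + 1) M fun ξ η => ξ * f ξ η := by
  obtain ⟨c, hc, hcM⟩ := hf
  refine ⟨mulFstCoeff c, fun ξ η => by rw [polyEval_mulFstCoeff, ← hc], ?_⟩
  simp only [abs_mulFstCoeff]
  exact (polyEval_mulFstCoeff n _ 1 1).trans_le (by simpa using hcM)

lemma snd_mul (hf : PolyBound n M f) : PolyBound (n + 1) M fun ξ η => η * f ξ η := by
  obtain ⟨c, hc, hcM⟩ := hf
  refine ⟨mulSndCoeff c, fun ξ η => by rw [polyEval_mulSndCoeff, ← hc], ?_⟩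
  simp only [abs_mulSndCoeff]
  exact (polyEval_mulSndCoeff n _ 1 1).trans_le (by simpa using hcM)

lemma fst_add_mul (hf : PolyBound n M f) {z : ℝ} (hz : |z| ≤ 1) :
    PolyBound (n + 1) (2 * M) fun ξ η => (ξ + z) * f ξ η := by
  have h := (hf.fst_mul.add ((hf.const_mul z).mono_degree n.le_succ)).mono_bound
    (N := 2 * M) (by nlinarith [hf.nonneg])
  simpa only [add_mul] using h

lemma snd_add_mul (hf : PolyBound n M f) {w : ℝ} (hw : |w| ≤ 1) :
    PolyBound (n + 1) (2 * M) fun ξ η => (η + w) * f ξ η := by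
  have h := (hf.snd_mul.add ((hf.const_mul w).mono_degree n.le_succ)).mono_bound
    (N := 2 * M) (by nlinarith [hf.nonneg])
  simpa only [add_mul] using h

lemma translated_monomial {z w : ℝ} (hz : |z| ≤ 1) (hw : |w| ≤ 1) (m n : ℕ) :
    PolyBound (m + n) (2 ^ (m + n)) fun ξ η => (ξ + z) ^ m * (η + w) ^ n := by
  induction n with
  | zero =>
    induction m with
    | zero => simpa using one
    | succ m ih =>
      have h := ih.fst_add_mul hz
      simpa [pow_succ, mul_comm, mul_left_comm, mul_assoc] using h
  | succ n ih =>
    have h := ih.snd_add_mul hw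
    simpa [pow_succ, mul_comm, mul_left_comm, mul_assoc, ← add_assoc] using h

lemma sum {ι : Type*} (s : Finset ι) {M : ι → ℝ} {f : ι → ℝ → ℝ → ℝ}
    (h : ∀ i ∈ s, PolyBound n (M i) (f i)) :
    PolyBound n (∑ i ∈ s, M i) fun ξ η => ∑ i ∈ s, f i ξ η := by
  classical
  induction s using Finset.induction_on with
  | empty => simpa using zero n
  | insert i s hi ih =>
    simp only [Finset.sum_insert hi]
    exact (h i (s.mem_insert_self i)).add (ih fun k hk => h k (Finset.mem_insert_of_mem hk))

end PolyBound

lemma abs_coeff_le_polyEval_abs {n i j : ℕ} (c : ℕ → ℕ → ℝ) (hi : i ≤ n) (hj : j ≤ i) :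
    |c i j| ≤ polyEval n (fun i j => |c i j|) 1 1 := by
  simp only [polyEval, one_pow, mul_one]
  calc |c i j| ≤ ∑ j ∈ Finset.range (i + 1), |c i j| :=
        Finset.single_le_sum (f := fun j => |c i j|) (fun _ _ => abs_nonneg _)
          (Finset.mem_range.2 (Nat.lt_succ_of_le hj))
    _ ≤ _ := Finset.single_le_sum (f := fun i => ∑ j ∈ Finset.range (i + 1), |c i j|)
          (fun _ _ => Finset.sum_nonneg fun _ _ => abs_nonneg _)
          (Finset.mem_range.2 (Nat.lt_succ_of_le hi))

/-- The homogeneous components of a polynomial function are determined by the function. -/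
lemma homogeneous_part_unique {n k : ℕ} (hk : k ≤ n) {c e : ℕ → ℕ → ℝ}
    (h : ∀ ξ η, polyEval n c ξ η = polyEval n e ξ η) (ξ η : ℝ) :
    ∑ j ∈ Finset.range (k + 1), c k j * ξ ^ (k - j) * η ^ j =
      ∑ j ∈ Finset.range (k + 1), e k j * ξ ^ (k - j) * η ^ j := by
  let P (c : ℕ → ℕ → ℝ) : Polynomial ℝ := ∑ i ∈ Finset.range (n + 1),
    Polynomial.monomial i (∑ j ∈ Finset.range (i + 1), c i j * ξ ^ (i - j) * η ^ j)
  have heval : ∀ c t, (P c).eval t = polyEval n c (t * ξ) (t * η) := by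
    intro c t
    simp only [P, Polynomial.eval_finsetSum, Polynomial.eval_monomial, polyEval, Finset.sum_mul]
    refine Finset.sum_congr rfl fun i _ => Finset.sum_congr rfl fun j hj => ?_
    have hj' : j ≤ i := by simpa [Nat.lt_succ_iff] using hj
    obtain ⟨l, rfl⟩ := Nat.exists_eq_add_of_le hj'
    rw [Nat.add_sub_cancel_left]
    ring
  have hcoeff : ∀ c, (P c).coeff k =
      ∑ j ∈ Finset.range (k + 1), c k j * ξ ^ (k - j) * η ^ j := by
    intro c
    simp only [P, Polynomial.finsetSum_coeff, Polynomial.coeff_monomial]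
    rw [Finset.sum_ite_eq' (Finset.range (n + 1)) k, if_pos (Finset.mem_range.2 (by omega))]
  have hP : P c = P e := Polynomial.funext fun t => by rw [heval, heval, h]
  rw [← hcoeff, ← hcoeff, hP]

lemma quadratic_coeff_unique {n : ℕ} (hn : 2 ≤ n) {c e : ℕ → ℕ → ℝ}
    (h : ∀ ξ η, polyEval n c ξ η = polyEval n e ξ η) :
    c 2 0 = e 2 0 ∧ c 2 1 = e 2 1 ∧ c 2 2 = e 2 2 := by
  have key := homogeneous_part_unique hn h
  have h1 := key 1 0
  have h2 := key 0 1
  have h3 := key 1 1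
  simp [Finset.sum_range_succ] at h1 h2 h3
  exact ⟨h1, by linarith, h2⟩

/-- A linear substitution maps homogeneous polynomials to homogeneous ones. -/
lemma exists_coeff_linear_monomial (p q r s : ℝ) (m n : ℕ) :
    ∃ c : ℕ → ℝ, ∀ ξ η : ℝ, (p * ξ + q * η) ^ m * (r * ξ + s * η) ^ n =
      ∑ j ∈ Finset.range (m + n + 1), c j * ξ ^ (m + n - j) * η ^ j := by
  have step : ∀ (k : ℕ) (f : ℝ → ℝ → ℝ) (p q : ℝ),
      (∃ c : ℕ → ℝ, ∀ ξ η, f ξ η = ∑ j ∈ Finset.range (k + 1), c j * ξ ^ (k - j) * η ^ j) →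
      ∃ c : ℕ → ℝ, ∀ ξ η, f ξ η * (p * ξ + q * η) =
        ∑ j ∈ Finset.range (k + 1 + 1), c j * ξ ^ (k + 1 - j) * η ^ j := by
    rintro k f p q ⟨c, hc⟩
    refine ⟨fun j => p * (if j ≤ k then c j else 0) + q * (if j = 0 then 0 else c (j - 1)),
      fun ξ η => ?_⟩
    simp only [add_mul, Finset.sum_add_distrib]
    rw [Finset.sum_range_succ, Finset.sum_range_succ' (fun j => q * _ * _ * _), hc, mul_add,
      Finset.sum_mul, Finset.sum_mul]
    simp only [show ¬ k + 1 ≤ k by omega, if_false, if_true, mul_zero, zero_mul, add_zero,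
      Nat.add_sub_add_right, Nat.add_sub_cancel, Nat.succ_ne_zero]
    congr 1
    · refine Finset.sum_congr rfl fun j hj => ?_
      have hj' : j ≤ k := by simpa [Nat.lt_succ_iff] using hj
      rw [if_pos hj', show k + 1 - j = (k - j) + 1 by omega]
      ring
    · exact Finset.sum_congr rfl fun j _ => by ring
  induction n with
  | zero =>
    induction m with
    | zero => exact ⟨fun _ => 1, by simp⟩
    | succ m ih =>
      obtain ⟨c, hc⟩ := step _ _ p q ih
      exact ⟨c, fun ξ η => by simpa [pow_succ] using hc ξ η⟩
  | succ n ih =>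
    obtain ⟨c, hc⟩ := step _ _ r s ih
    exact ⟨c, fun ξ η => by simpa [pow_succ, ← add_assoc, mul_assoc] using hc ξ η⟩

lemma exists_coeff_linear_comp (b : ℕ → ℕ → ℝ) (p q r s : ℝ) (i : ℕ) :
    ∃ c : ℕ → ℝ, ∀ ξ η : ℝ,
      ∑ j ∈ Finset.range (i + 1), b i j * (p * ξ + q * η) ^ (i - j) * (r * ξ + s * η) ^ j =
        ∑ j ∈ Finset.range (i + 1), c j * ξ ^ (i - j) * η ^ j := by
  choose c hc using fun j => exists_coeff_linear_monomial p q r s (i - j) j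
  refine ⟨fun l => ∑ j ∈ Finset.range (i + 1), b i j * c j l, fun ξ η => ?_⟩
  simp only [Finset.sum_mul]
  rw [Finset.sum_comm]
  refine Finset.sum_congr rfl fun j hj => ?_
  have hj' : i - j + j = i := Nat.sub_add_cancel (by simpa [Nat.lt_succ_iff] using hj)
  rw [mul_assoc, hc, hj', Finset.mul_sum]
  exact Finset.sum_congr rfl fun l _ => by ring

/-- The coefficients of the translate of `h` to a point of the unit square. -/
lemma exists_translated_coeff {d : ℕ} (hd : 3 ≤ d) {ε : ℝ} {a : ℕ → ℕ → ℝ}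
    (ha : CoeffSmall d ε a) {ζ : ℝ × ℝ} (hζ : ζ ∈ unitSq) :
    ∃ b : ℕ → ℕ → ℝ, (∀ ξ η, hpoly d a (ξ + ζ.1) (η + ζ.2) = polyEval d b ξ η) ∧
      |b 2 0| ≤ 4 * ε ∧ |b 2 1 - 1| ≤ 4 * ε ∧ |b 2 2| ≤ 4 * ε := by
  obtain ⟨⟨hz1, hz2⟩, hw1, hw2⟩ := hζ
  have hz : |ζ.1| ≤ 1 := abs_le.2 ⟨hz1, hz2⟩
  have hw : |ζ.2| ≤ 1 := abs_le.2 ⟨hw1, hw2⟩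
  have mon := fun m n => PolyBound.translated_monomial hz hw m n
  have hquad := (((mon 2 0).const_mul (a 2 0)).add ((mon 0 2).const_mul (a 2 2))).mono_degree
    (show 2 ≤ d by omega)
  have hhigh : PolyBound d
      (∑ i ∈ Finset.Icc 3 d, ∑ j ∈ Finset.range (i + 1), |a i j| * 100 ^ d)
      fun ξ η => ∑ i ∈ Finset.Icc 3 d, ∑ j ∈ Finset.range (i + 1),
        a i j * ((ξ + ζ.1) ^ (i - j) * (η + ζ.2) ^ j) := by
    refine PolyBound.sum _ fun i hi => PolyBound.sum _ fun j hj => PolyBound.const_mul ?_ _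
    have hj' : i - j + j = i := Nat.sub_add_cancel (by simpa [Nat.lt_succ_iff] using hj)
    have hid := (Finset.mem_Icc.1 hi).2
    refine ((mon (i - j) j).mono_degree (hj'.trans_le hid)).mono_bound ?_
    rw [hj']
    calc (2 : ℝ) ^ i ≤ 2 ^ d := pow_le_pow_right₀ (by norm_num) hid
      _ ≤ 100 ^ d := pow_le_pow_left₀ (by norm_num) (by norm_num) d
  obtain ⟨c, hc, hcM⟩ := hquad.add hhigh
  have hcε : polyEval d (fun i j => |c i j|) 1 1 ≤ 4 * ε := by
    refine hcM.trans ?_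
    simp only [← Finset.sum_mul]
    unfold CoeffSmall at ha
    have : 0 ≤ 100 ^ d * ∑ i ∈ Finset.Icc 3 d, ∑ j ∈ Finset.range (i + 1), |a i j| := by
      positivity
    norm_num
    linarith
  let e : ℕ → ℕ → ℝ := fun i j =>
    if i = 0 then ζ.1 * ζ.2 else if i = 1 then (if j = 0 then ζ.2 else ζ.1)
      else if i = 2 ∧ j = 1 then 1 else 0
  have he : ∀ ξ η, polyEval d e ξ η = (ξ + ζ.1) * (η + ζ.2) := by
    intro ξ η
    unfold polyEval
    rw [← Finset.sum_subset (Finset.range_mono (show 3 ≤ d + 1 by omega))]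
    · simp [Finset.sum_range_succ, e]
      ring
    · intro i _ hi
      have hi' : 3 ≤ i := by simpa using hi
      simp [e, show i ≠ 0 by omega, show i ≠ 1 by omega, show i ≠ 2 by omega]
  refine ⟨fun i j => e i j + c i j, fun ξ η => ?_, ?_, ?_, ?_⟩
  · have hadd : polyEval d (fun i j => e i j + c i j) ξ η = polyEval d e ξ η + polyEval d c ξ η := by
      simp only [polyEval, add_mul, Finset.sum_add_distrib]
    rw [hadd, he, ← hc]
    simp only [hpoly, pow_zero, mul_one, one_mul, mul_assoc]
    ring
  · simpa [e] using (abs_coeff_le_polyEval_abs c (show 2 ≤ d by omega) (by norm_num)).trans hcε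
  · simpa [e] using (abs_coeff_le_polyEval_abs c (show 2 ≤ d by omega)
      (show 1 ≤ 2 by norm_num)).trans hcε
  · simpa [e] using (abs_coeff_le_polyEval_abs c (show 2 ≤ d by omega) (le_refl 2)).trans hcε

/-- A linear automorphism of the plane given by a matrix of nonzero determinant. -/
def planeEquiv (p q r s : ℝ) (h : p * s - q * r ≠ 0) : (ℝ × ℝ) ≃ₗ[ℝ] (ℝ × ℝ) where
  toFun v := (p * v.1 + q * v.2, r * v.1 + s * v.2)
  map_add' v w := by ext <;> simp <;> ring
  map_smul' t v := by ext <;> simp <;> ring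
  invFun v := (s / (p * s - q * r) * v.1 + -q / (p * s - q * r) * v.2,
    -r / (p * s - q * r) * v.1 + p / (p * s - q * r) * v.2)
  left_inv v := by
    ext <;> simp only <;> rw [div_mul_eq_mul_div, div_mul_eq_mul_div, ← add_div,
      div_eq_iff h] <;> ring
  right_inv v := by
    have h' := mul_inv_cancel₀ h
    ext
    · simp only [div_eq_mul_inv]
      linear_combination v.1 * h'
    · simp only [div_eq_mul_inv]
      linear_combination v.2 * h'

/-- A quadratic form close to `ξη` is a product of two linear forms close to `ξ` and `η`. -/
lemma exists_factorization {A B D δ : ℝ} (hA : |A| ≤ δ) (hB : |B - 1| ≤ δ) (hD : |D| ≤ δ)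
    (hδ : δ ≤ 1 / 10) :
    ∃ β γ : ℝ, |β - 1| ≤ 2 * δ ∧ |γ| ≤ 2 * δ ∧ β * 1 - D * γ ≠ 0 ∧
      ∀ x y : ℝ, A * x ^ 2 + B * (x * y) + D * y ^ 2 = (β * x + D * y) * (γ * x + 1 * y) := by
  rw [abs_le] at hA hB hD
  have hAD : |A * D| ≤ δ * δ := by
    rw [abs_mul]
    exact mul_le_mul (abs_le.2 hA) (abs_le.2 hD) (abs_nonneg _) (by linarith)
  rw [abs_le] at hAD
  have hpos : 0 < B ^ 2 - 4 * (A * D) := by nlinarith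
  obtain ⟨w, hw, hw2⟩ : ∃ w : ℝ, 0 < w ∧ w ^ 2 = B ^ 2 - 4 * (A * D) :=
    ⟨√(B ^ 2 - 4 * (A * D)), Real.sqrt_pos.2 hpos, Real.sq_sqrt hpos.le⟩
  have hw_le : w ≤ 1 + 3 * δ := by nlinarith
  have hw_ge : 1 - 3 * δ ≤ w := by nlinarith
  have hβ : 1 / 2 ≤ (B + w) / 2 := by linarith
  have hβ0 : (B + w) ≠ 0 := by linarith
  have hγ : (B + w) / 2 * (A / ((B + w) / 2)) = A := by field_simp
  have hDγ : D * (A / ((B + w) / 2)) = (B - w) / 2 := by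
    field_simp
    nlinarith
  refine ⟨(B + w) / 2, A / ((B + w) / 2), abs_le.2 ⟨by linarith, by linarith⟩, ?_, ?_, ?_⟩
  · rw [abs_div, abs_of_pos (show 0 < (B + w) / 2 by linarith), div_le_iff₀ (by linarith)]
    refine (abs_le.2 hA).trans ?_
    nlinarith
  · rw [hDγ]
    intro h
    linarith
  · intro x y
    linear_combination -(x ^ 2) * hγ - (x * y) * hDγ

/-- normalization of the quadratic part at a point `ζ`.
The translated coefficients are `O(ε₀)`-close to those of `ξη`, and an affine
perturbation `T_{ζ,2}` of the identity makes the quadratic part exactly `ξη`. -/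
theorem statement8 (d : ℕ) (hd : 3 ≤ d) :
    ∃ C : ℝ, 0 < C ∧ ∃ ε₀' > (0 : ℝ), ∀ ε₀ : ℝ, 0 < ε₀ → ε₀ ≤ ε₀' →
      ∀ a : ℕ → ℕ → ℝ, CoeffSmall d ε₀ a →
        ∀ ζ : ℝ × ℝ, ζ ∈ unitSq →
          (∀ a' : ℕ → ℕ → ℝ,
            (∀ ξ η : ℝ, hpoly d a (ξ + ζ.1) (η + ζ.2) =
              ∑ i ∈ Finset.range (d + 1), ∑ j ∈ Finset.range (i + 1),
                a' i j * ξ ^ (i - j) * η ^ j) →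
            |a' 2 0| + |a' 2 2| ≤ C * ε₀ ∧ |a' 2 1 - 1| ≤ C * ε₀) ∧
          ∃ T : (ℝ × ℝ) ≃ᵃ[ℝ] (ℝ × ℝ),
            (∀ p : ℝ × ℝ, ‖T p - p‖ ≤ C * ε₀ * (1 + ‖p‖)) ∧
            ∃ a'' : ℕ → ℕ → ℝ,
              (∀ ξ η : ℝ,
                hpoly d a ((T.symm (ξ, η)).1 + ζ.1) ((T.symm (ξ, η)).2 + ζ.2) =
                  ∑ i ∈ Finset.range (d + 1), ∑ j ∈ Finset.range (i + 1),
                    a'' i j * ξ ^ (i - j) * η ^ j) ∧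
              a'' 2 1 = 1 ∧ a'' 2 0 = 0 ∧ a'' 2 2 = 0 := by
  refine ⟨12, by norm_num, 1 / 40, by norm_num, fun ε hε hε' a ha ζ hζ => ?_⟩
  obtain ⟨b, hb, hb0, hb1, hb2⟩ := exists_translated_coeff hd ha hζ
  constructor
  · intro a' ha'
    obtain ⟨h0, h1, h2⟩ := quadratic_coeff_unique (c := a') (e := b) (show 2 ≤ d by omega)
      fun ξ η => (ha' ξ η).symm.trans (hb ξ η)
    rw [h0, h1, h2]
    constructor <;> linarith
  obtain ⟨β, γ, hβ, hγ, hdet, hfac⟩ := exists_factorization hb0 hb1 hb2 (by linarith)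
  set T := planeEquiv β (b 2 2) γ 1 hdet with hT
  refine ⟨T.toAffineEquiv, fun v => ?_, ?_⟩
  · have hv : T v - v = ((β - 1) * v.1 + b 2 2 * v.2, γ * v.1) := by
      ext <;> simp [hT, planeEquiv]
      ring
    have h1 : |v.1| ≤ ‖v‖ := norm_fst_le v
    have h2 : |v.2| ≤ ‖v‖ := norm_snd_le v
    have hx : |(β - 1) * v.1| ≤ 2 * (4 * ε) * ‖v‖ := by
      rw [abs_mul]; gcongr
    have hy : |b 2 2 * v.2| ≤ 4 * ε * ‖v‖ := by
      rw [abs_mul]; gcongr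
    have hz : |γ * v.1| ≤ 2 * (4 * ε) * ‖v‖ := by
      rw [abs_mul]; gcongr
    have hεv : 0 ≤ ε * ‖v‖ := by positivity
    change ‖T v - v‖ ≤ _
    rw [hv, Prod.norm_mk]
    refine max_le ?_ ?_
    · refine (abs_add_le _ _).trans ?_
      linarith
    · rw [Real.norm_eq_abs]
      linarith
  · obtain ⟨p, q, r, s, hS⟩ : ∃ p q r s : ℝ, ∀ ξ η : ℝ,
        T.symm (ξ, η) = (p * ξ + q * η, r * ξ + s * η) := ⟨_, _, _, _, fun _ _ => rfl⟩
    choose c hc using exists_coeff_linear_comp b p q r s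
    refine ⟨fun i j => if i = 2 then (if j = 1 then 1 else 0) else c i j, fun ξ η => ?_,
      by simp, by simp, by simp⟩
    change hpoly d a ((T.symm (ξ, η)).1 + ζ.1) ((T.symm (ξ, η)).2 + ζ.2) = _
    rw [hb, polyEval, hS]
    refine Finset.sum_congr rfl fun i _ => ?_
    by_cases hi : i = 2
    · subst hi
      have hTS : T (p * ξ + q * η, r * ξ + s * η) = (ξ, η) := by
        rw [← hS, LinearEquiv.apply_symm_apply]
      have hfst := congrArg Prod.fst hTS
      have hsnd := congrArg Prod.snd hTS
      have hprod := hfac (p * ξ + q * η) (r * ξ + s * η)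
      simp only [hT, planeEquiv, LinearEquiv.coe_mk, LinearMap.coe_mk, AddHom.coe_mk]
        at hfst hsnd
      rw [hfst, hsnd] at hprod
      simp [Finset.sum_range_succ]
      linarith
    · simpa [hi] using hc i ξ η
end
end

section
/- Let ε₀ > 0 be sufficiently small, let K_L be sufficiently large, let h₀(ξ,η) = ξη + Σ_{i=3}^{d} Σ_{j=0}^{i} b_{i,j} ξ^{i−j} η^{j} with 100^d Σ|b_{i,j}| ≤ ε₀, let ζ̄ = (ζ̄₁,ζ̄₂) ∈ [-2,2]² satisfy |ζ̄| > (2K_L)^{-1} and |ζ̄₁| ≥ |ζ̄₂|, and let P(ξ,η) = ∂₁h₀(ξ,η)·∂₂h₀(ζ̄) − ∂₂h₀(ξ,η)·∂₁h₀(ζ̄). Then there is a smooth function η₀ : [-4,4] → ℝ with η₀(0) = 0 such that the zero set {P = 0} intersected with [-4,4]² equals {(ξ, η₀(ξ)) : ξ ∈ [-4,4]} ∩ [-4,4]²; moreover η₀'(ξ) = [∂₁₂h₀(ξ,η₀(ξ))·∂₁h₀(ζ̄) − ∂₁₁h₀(ξ,η₀(ξ))·∂₂h₀(ζ̄)] /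 [∂₁₂h₀(ξ,η₀(ξ))·∂₂h₀(ζ̄) − ∂₂₂h₀(ξ,η₀(ξ))·∂₁h₀(ζ̄)] (the denominator being nonzero), η₀'(0) = ∂₁h₀(ζ̄)/∂₂h₀(ζ̄), and for every j = 1, …, d there is a constant C_d depending only on d with |η₀^{(j)}(ξ)| ≤ C_d for all ξ ∈ [-4,4]. -/
noncomputable section

/-- The normalized polynomial `h₀(ξ,η) = ξη + Σ_{i=3}^d Σ_{j=0}^i b_{i,j} ξ^{i-j} η^j`. -/
def hpoly0 (d : ℕ) (b : ℕ → ℕ → ℝ) (ξ η : ℝ) : ℝ :=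
  ξ * η + ∑ i ∈ Finset.Icc 3 d, ∑ j ∈ Finset.range (i + 1), b i j * ξ ^ (i - j) * η ^ j

/-- Smallness of the higher order coefficients: `100^d Σ |b_{i,j}| ≤ ε₀`. -/
def CoeffSmall0 (d : ℕ) (ε₀ : ℝ) (b : ℕ → ℕ → ℝ) : Prop :=
  100 ^ d * ∑ i ∈ Finset.Icc 3 d, ∑ j ∈ Finset.range (i + 1), |b i j| ≤ ε₀

/-- Partial derivative in the first variable. -/
def pd1 (g : ℝ → ℝ → ℝ) : ℝ → ℝ → ℝ := fun x y => deriv (fun s => g s y) x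

/-- Partial derivative in the second variable. -/
def pd2 (g : ℝ → ℝ → ℝ) : ℝ → ℝ → ℝ := fun x y => deriv (fun t => g x t) y

/-- Second partial derivative `∂₁∂₁`. -/
def pd11 (g : ℝ → ℝ → ℝ) : ℝ → ℝ → ℝ := fun x y => deriv (fun s => pd1 g s y) x

/-- Mixed partial derivative `∂₁∂₂`. -/
def pd12 (g : ℝ → ℝ → ℝ) : ℝ → ℝ → ℝ := fun x y => deriv (fun s => pd2 g s y) x

/-- Second partial derivative `∂₂∂₂`. -/
def pd22 (g : ℝ → ℝ → ℝ) : ℝ → ℝ → ℝ := fun x y => deriv (fun t => pd2 g x t) y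

open scoped ContDiff Topology

/-- Explicit first partial derivative of `hpoly0` in the first variable. -/
def hpolyX (d : ℕ) (b : ℕ → ℕ → ℝ) (x y : ℝ) : ℝ :=
  y + ∑ i ∈ Finset.Icc 3 d, ∑ j ∈ Finset.range (i + 1),
    b i j * (((i - j : ℕ) : ℝ) * x ^ (i - j - 1)) * y ^ j

/-- Explicit first partial derivative of `hpoly0` in the second variable. -/
def hpolyY (d : ℕ) (b : ℕ → ℕ → ℝ) (x y : ℝ) : ℝ :=
  x + ∑ i ∈ Finset.Icc 3 d, ∑ j ∈ Finset.range (i + 1),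
    b i j * x ^ (i - j) * ((j : ℝ) * y ^ (j - 1))

/-- Explicit pure second partial derivative of `hpoly0` in the first variable. -/
def hpolyXX (d : ℕ) (b : ℕ → ℕ → ℝ) (x y : ℝ) : ℝ :=
  ∑ i ∈ Finset.Icc 3 d, ∑ j ∈ Finset.range (i + 1),
    b i j * (((i - j : ℕ) : ℝ) * (((i - j - 1 : ℕ) : ℝ) * x ^ (i - j - 1 - 1))) * y ^ j

/-- Explicit mixed second partial derivative of `hpoly0`. -/
def hpolyXY (d : ℕ) (b : ℕ → ℕ → ℝ) (x y : ℝ) : ℝ :=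
  1 + ∑ i ∈ Finset.Icc 3 d, ∑ j ∈ Finset.range (i + 1),
    b i j * (((i - j : ℕ) : ℝ) * x ^ (i - j - 1)) * ((j : ℝ) * y ^ (j - 1))

/-- Explicit pure second partial derivative of `hpoly0` in the second variable. -/
def hpolyYY (d : ℕ) (b : ℕ → ℕ → ℝ) (x y : ℝ) : ℝ :=
  ∑ i ∈ Finset.Icc 3 d, ∑ j ∈ Finset.range (i + 1),
    b i j * x ^ (i - j) * ((j : ℝ) * (((j - 1 : ℕ) : ℝ) * y ^ (j - 1 - 1)))

section Partials

variable (d : ℕ) (b : ℕ → ℕ → ℝ)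

theorem hasDerivAt_hpoly0_fst (x y : ℝ) :
    HasDerivAt (fun s => hpoly0 d b s y) (hpolyX d b x y) x := by
  unfold hpoly0 hpolyX
  refine HasDerivAt.add ?_ (HasDerivAt.fun_sum fun i _ => HasDerivAt.fun_sum fun j _ => ?_)
  · simpa using (hasDerivAt_id x).mul_const y
  · exact ((hasDerivAt_pow (i - j) x).const_mul (b i j)).mul_const (y ^ j)

theorem hasDerivAt_hpoly0_snd (x y : ℝ) :
    HasDerivAt (fun t => hpoly0 d b x t) (hpolyY d b x y) y := by
  unfold hpoly0 hpolyY
  refine HasDerivAt.add ?_ (HasDerivAt.fun_sum fun i _ => HasDerivAt.fun_sum fun j _ => ?_)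
  · simpa using (hasDerivAt_id y).const_mul x
  · exact (hasDerivAt_pow j y).const_mul (b i j * x ^ (i - j))

theorem hasDerivAt_hpolyX_fst (x y : ℝ) :
    HasDerivAt (fun s => hpolyX d b s y) (hpolyXX d b x y) x := by
  unfold hpolyX hpolyXX
  refine (HasDerivAt.fun_sum fun i _ => HasDerivAt.fun_sum fun j _ => ?_).const_add y
  exact (((hasDerivAt_pow (i - j - 1) x).const_mul _).const_mul (b i j)).mul_const (y ^ j)

theorem hasDerivAt_hpolyX_snd (x y : ℝ) :
    HasDerivAt (fun t => hpolyX d b x t) (hpolyXY d b x y) y := by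
  unfold hpolyX hpolyXY
  refine (hasDerivAt_id y).add (HasDerivAt.fun_sum fun i _ => HasDerivAt.fun_sum fun j _ => ?_)
  exact (hasDerivAt_pow j y).const_mul _

theorem hasDerivAt_hpolyY_fst (x y : ℝ) :
    HasDerivAt (fun s => hpolyY d b s y) (hpolyXY d b x y) x := by
  unfold hpolyY hpolyXY
  refine (hasDerivAt_id x).add (HasDerivAt.fun_sum fun i _ => HasDerivAt.fun_sum fun j _ => ?_)
  exact ((hasDerivAt_pow (i - j) x).const_mul (b i j)).mul_const _

theorem hasDerivAt_hpolyY_snd (x y : ℝ) :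
    HasDerivAt (fun t => hpolyY d b x t) (hpolyYY d b x y) y := by
  unfold hpolyY hpolyYY
  refine (HasDerivAt.fun_sum fun i _ => HasDerivAt.fun_sum fun j _ => ?_).const_add x
  exact ((hasDerivAt_pow (j - 1) y).const_mul _).const_mul _

theorem pd1_hpoly0 : pd1 (hpoly0 d b) = hpolyX d b :=
  funext₂ fun x y => (hasDerivAt_hpoly0_fst d b x y).deriv

theorem pd2_hpoly0 : pd2 (hpoly0 d b) = hpolyY d b :=
  funext₂ fun x y => (hasDerivAt_hpoly0_snd d b x y).deriv

theorem pd11_hpoly0 : pd11 (hpoly0 d b) = hpolyXX d b := by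
  funext x y
  simpa only [pd11, pd1_hpoly0] using (hasDerivAt_hpolyX_fst d b x y).deriv

theorem pd12_hpoly0 : pd12 (hpoly0 d b) = hpolyXY d b := by
  funext x y
  simpa only [pd12, pd2_hpoly0] using (hasDerivAt_hpolyY_fst d b x y).deriv

theorem pd22_hpoly0 : pd22 (hpoly0 d b) = hpolyYY d b := by
  funext x y
  simpa only [pd22, pd2_hpoly0] using (hasDerivAt_hpolyY_snd d b x y).deriv

/-- The factor by which the coefficient bound is multiplied when estimating the derivatives of the
higher order part of `hpoly0` on `[-6,6]²`. -/
def hpolyWeight (d : ℕ) : ℝ :=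
  ∑ i ∈ Finset.Icc 3 d, ∑ _j ∈ Finset.range (i + 1), (i : ℝ) ^ 2 * 6 ^ i

theorem hpolyWeight_nonneg : 0 ≤ hpolyWeight d :=
  Finset.sum_nonneg fun _ _ => Finset.sum_nonneg fun _ _ => by positivity

variable {d b}

theorem abs_sum_le_mul_hpolyWeight {δ t : ℝ} {T : ℕ → ℕ → ℝ} (hδ : 0 ≤ δ)
    (hb : ∀ i j, |b i j| ≤ δ)
    (hT : ∀ i j, 3 ≤ i → j ≤ i → |T i j| ≤ (i : ℝ) ^ 2 * 6 ^ i * t) :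
    |∑ i ∈ Finset.Icc 3 d, ∑ j ∈ Finset.range (i + 1), b i j * T i j| ≤
      δ * (hpolyWeight d * t) := by
  unfold hpolyWeight
  simp only [Finset.mul_sum, Finset.sum_mul]
  refine (Finset.abs_sum_le_sum_abs _ _).trans (Finset.sum_le_sum fun i hi => ?_)
  refine (Finset.abs_sum_le_sum_abs _ _).trans (Finset.sum_le_sum fun j hj => ?_)
  rw [abs_mul]
  exact mul_le_mul (hb i j)
    (hT i j (Finset.mem_Icc.1 hi).1 (Nat.lt_succ_iff.1 (Finset.mem_range.1 hj)))
    (abs_nonneg _) hδ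

theorem abs_monomial_le {x y t : ℝ} {i e f n : ℕ} (hx : |x| ≤ t) (hy : |y| ≤ t)
    (ht : t ≤ 6) (hef : n ≠ 0 → 1 ≤ e + f) (hi : e + f ≤ i) (hn : n ≤ i ^ 2) :
    |(n : ℝ) * (x ^ e * y ^ f)| ≤ (i : ℝ) ^ 2 * 6 ^ i * t := by
  have ht0 : 0 ≤ t := (abs_nonneg x).trans hx
  rcases eq_or_ne n 0 with rfl | h0
  · simp only [Nat.cast_zero, zero_mul, abs_zero]
    positivity
  have h1 : |x ^ e * y ^ f| ≤ t ^ (e + f) := by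
    rw [abs_mul, abs_pow, abs_pow, pow_add]
    gcongr
  have h2 : t ^ (e + f) ≤ 6 ^ i * t := by
    obtain ⟨k, hk⟩ := Nat.exists_eq_add_of_le (hef h0)
    rw [hk, pow_add, pow_one, mul_comm]
    gcongr
    calc t ^ k ≤ 6 ^ k := by gcongr
      _ ≤ 6 ^ i := pow_le_pow_right₀ (by norm_num) (by omega)
  rw [abs_mul, mul_assoc, Nat.abs_cast]
  exact mul_le_mul (by exact_mod_cast hn) (h1.trans h2) (abs_nonneg _) (by positivity)

theorem abs_hpolyX_sub_le {x y t δ : ℝ} (hδ : 0 ≤ δ) (hb : ∀ i j, |b i j| ≤ δ)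
    (hx : |x| ≤ t) (hy : |y| ≤ t) (ht : t ≤ 6) :
    |hpolyX d b x y - y| ≤ δ * (hpolyWeight d * t) := by
  rw [hpolyX, add_sub_cancel_left]
  simp only [mul_assoc]
  refine abs_sum_le_mul_hpolyWeight hδ hb fun i j hi hj => ?_
  exact abs_monomial_le hx hy ht (by omega) (by omega) (by nlinarith [Nat.sub_le i j])

theorem abs_hpolyY_sub_le {x y t δ : ℝ} (hδ : 0 ≤ δ) (hb : ∀ i j, |b i j| ≤ δ)
    (hx : |x| ≤ t) (hy : |y| ≤ t) (ht : t ≤ 6) :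
    |hpolyY d b x y - x| ≤ δ * (hpolyWeight d * t) := by
  rw [hpolyY, add_sub_cancel_left]
  simp only [mul_assoc]
  refine abs_sum_le_mul_hpolyWeight hδ hb fun i j hi hj => ?_
  rw [mul_left_comm]
  exact abs_monomial_le hx hy ht (by omega) (by omega) (by nlinarith)

theorem abs_hpolyXY_sub_le {x y t δ : ℝ} (hδ : 0 ≤ δ) (hb : ∀ i j, |b i j| ≤ δ)
    (hx : |x| ≤ t) (hy : |y| ≤ t) (ht : t ≤ 6) :
    |hpolyXY d b x y - 1| ≤ δ * (hpolyWeight d * t) := by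
  rw [hpolyXY, add_sub_cancel_left]
  simp only [mul_assoc]
  refine abs_sum_le_mul_hpolyWeight hδ hb fun i j hi hj => ?_
  rw [mul_left_comm (x ^ _), ← mul_assoc, ← Nat.cast_mul]
  refine abs_monomial_le hx hy ht (fun h => ?_) (by omega) ?_
  · have := mul_ne_zero_iff.1 h
    omega
  · rw [sq]
    exact Nat.mul_le_mul (Nat.sub_le i j) hj

theorem abs_hpolyXX_le {x y t δ : ℝ} (hδ : 0 ≤ δ) (hb : ∀ i j, |b i j| ≤ δ)
    (hx : |x| ≤ t) (hy : |y| ≤ t) (ht : t ≤ 6) :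
    |hpolyXX d b x y| ≤ δ * (hpolyWeight d * t) := by
  rw [hpolyXX]
  simp only [mul_assoc]
  refine abs_sum_le_mul_hpolyWeight hδ hb fun i j hi hj => ?_
  rw [← mul_assoc, ← Nat.cast_mul]
  refine abs_monomial_le hx hy ht (fun h => ?_) (by omega) ?_
  · have := mul_ne_zero_iff.1 h
    omega
  · rw [sq]
    exact Nat.mul_le_mul (Nat.sub_le i j) ((Nat.sub_le _ 1).trans (Nat.sub_le i j))

theorem abs_hpolyYY_le {x y t δ : ℝ} (hδ : 0 ≤ δ) (hb : ∀ i j, |b i j| ≤ δ)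
    (hx : |x| ≤ t) (hy : |y| ≤ t) (ht : t ≤ 6) :
    |hpolyYY d b x y| ≤ δ * (hpolyWeight d * t) := by
  rw [hpolyYY]
  simp only [mul_assoc]
  refine abs_sum_le_mul_hpolyWeight hδ hb fun i j hi hj => ?_
  rw [mul_left_comm, mul_left_comm (x ^ _), ← mul_assoc, ← Nat.cast_mul]
  refine abs_monomial_le hx hy ht (fun h => ?_) (by omega) ?_
  · have := mul_ne_zero_iff.1 h
    omega
  · rw [sq]
    exact Nat.mul_le_mul hj ((Nat.sub_le j 1).trans hj)

end Partials

theorem exists_contDiffOn_zero {X : Type*} [NormedAddCommGroup X] [NormedSpace ℝ X]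
    [CompleteSpace X] {Q : X × ℝ → ℝ} (hQ : ContDiff ℝ ∞ Q) {U : Set X} (hU : IsOpen U) {M : ℝ}
    (hM : 0 ≤ M) (hneg : ∀ x ∈ U, Q (x, -M) < 0) (hpos : ∀ x ∈ U, 0 < Q (x, M))
    (hder : ∀ x ∈ U, ∀ η ∈ Set.Icc (-M) M, 0 < deriv (fun t => Q (x, t)) η) :
    ∃ ψ : X → ℝ, ContDiffOn ℝ ∞ ψ U ∧ ∀ x ∈ U, ψ x ∈ Set.Ioo (-M) M ∧
      ∀ η ∈ Set.Icc (-M) M, Q (x, η) = 0 ↔ η = ψ x := by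
  have key : ∀ x ∈ U, ∃ t ∈ Set.Ioo (-M) M, ∀ η ∈ Set.Icc (-M) M, Q (x, η) = 0 ↔ η = t := by
    intro x hx
    have hc : Continuous fun t => Q (x, t) := by
      have := hQ.continuous
      fun_prop
    have hmono : StrictMonoOn (fun t => Q (x, t)) (Set.Icc (-M) M) :=
      strictMonoOn_of_deriv_pos (convex_Icc _ _) hc.continuousOn
        fun η hη => hder x hx η (interior_subset hη)
    obtain ⟨t, ht, ht0⟩ := intermediate_value_Ioo (by linarith : -M ≤ M) hc.continuousOn
      (show (0 : ℝ) ∈ Set.Ioo (Q (x, -M)) (Q (x, M)) from ⟨hneg x hx, hpos x hx⟩)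
    refine ⟨t, ht, fun η hη => ⟨fun h => ?_, fun h => h ▸ ht0⟩⟩
    exact hmono.injOn hη (Set.Ioo_subset_Icc_self ht) (h.trans ht0.symm)
  choose! ψ hψ using key
  refine ⟨ψ, fun x hx => ContDiffAt.contDiffWithinAt ?_, hψ⟩
  have hx0 : Q (x, ψ x) = 0 :=
    ((hψ x hx).2 _ (Set.Ioo_subset_Icc_self (hψ x hx).1)).2 rfl
  have cdf : ContDiffAt ℝ ∞ Q (x, ψ x) := hQ.contDiffAt
  have hd : HasDerivAt (fun t => Q (x, t))
      ((fderiv ℝ Q (x, ψ x) ∘L .inr ℝ X ℝ) 1) (ψ x) := by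
    have h1 : HasFDerivAt Q (fderiv ℝ Q (x, ψ x)) (x, ψ x) :=
      (cdf.differentiableAt (by simp)).hasFDerivAt
    have h2 : HasFDerivAt (fun t : ℝ => (x, t)) (ContinuousLinearMap.inr ℝ X ℝ) (ψ x) :=
      hasFDerivAt_prodMk_right x (ψ x)
    exact (h1.comp (ψ x) h2).hasDerivAt
  have hne : (fderiv ℝ Q (x, ψ x) ∘L .inr ℝ X ℝ) 1 ≠ 0 := by
    rw [← hd.deriv]
    exact (hder x hx _ (Set.Ioo_subset_Icc_self (hψ x hx).1)).ne'
  have inv : (fderiv ℝ Q (x, ψ x) ∘L .inr ℝ X ℝ).IsInvertible := by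
    refine ⟨ContinuousLinearEquiv.unitsEquivAut ℝ (Units.mk0 _ hne), ?_⟩
    ext
    simp
  have hn : (∞ : ℕ∞ω) ≠ 0 := by simp
  have hφ := cdf.contDiffAt_implicitFunction hn inv
  refine hφ.congr_of_eventuallyEq ?_
  have hself : cdf.implicitFunction hn inv x = ψ x := cdf.implicitFunction_apply_self hn inv
  have hev := cdf.eventually_apply_implicitFunction hn inv
  have hnhds : ∀ᶠ y in 𝓝 x, cdf.implicitFunction hn inv y ∈ Set.Ioo (-M) M :=
    hφ.continuousAt.eventually_mem (isOpen_Ioo.mem_nhds (by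
      show cdf.implicitFunction hn inv x ∈ _
      rw [hself]; exact (hψ x hx).1))
  filter_upwards [hev, hnhds, hU.mem_nhds hx] with y h1 h2 h3
  exact (((hψ y h3).2 _ (Set.Ioo_subset_Icc_self h2)).1 (h1.trans hx0)).symm

theorem exists_bound_iteratedDeriv_snd {E : Type*} [NormedAddCommGroup E] [NormedSpace ℝ E]
    {U K : Set (E × ℝ)} (hU : IsOpen U) (hK : IsCompact K) (hKU : K ⊆ U) {ψ : E × ℝ → ℝ}
    (hψ : ContDiffOn ℝ ∞ ψ U) (j : ℕ) :
    ∃ C, 0 ≤ C ∧ ∀ p ξ, (p, ξ) ∈ K → |iteratedDeriv j (fun s => ψ (p, s)) ξ| ≤ C := by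
  have key : ∃ F : E × ℝ → ℝ, ContDiffOn ℝ ∞ F U ∧
      ∀ p ξ, (p, ξ) ∈ U → iteratedDeriv j (fun s => ψ (p, s)) ξ = F (p, ξ) := by
    induction j with
    | zero => exact ⟨ψ, hψ, by simp⟩
    | succ j ih =>
      obtain ⟨F, hF, hFe⟩ := ih
      refine ⟨fun q => fderiv ℝ F q (0, 1),
        (hF.fderiv_of_isOpen hU (m := ∞) (by simp)).clm_apply contDiffOn_const, ?_⟩
      intro p ξ hp
      rw [iteratedDeriv_succ]
      have hopen : ∀ᶠ s in 𝓝 ξ, (p, s) ∈ U :=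
        (show Continuous fun s : ℝ => (p, s) by fun_prop).continuousAt.eventually_mem
          (hU.mem_nhds hp)
      have he : iteratedDeriv j (fun s => ψ (p, s)) =ᶠ[𝓝 ξ] fun s => F (p, s) := by
        filter_upwards [hopen] with s hs using hFe p s hs
      rw [he.deriv_eq]
      have h1 : HasFDerivAt F (fderiv ℝ F (p, ξ)) (p, ξ) :=
        ((hF.contDiffAt (hU.mem_nhds hp)).differentiableAt (by simp)).hasFDerivAt
      have h2 : HasFDerivAt (fun t : ℝ => (p, t)) (ContinuousLinearMap.inr ℝ E ℝ) ξ :=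
        hasFDerivAt_prodMk_right p ξ
      simpa [Function.comp_def] using (h1.comp ξ h2).hasDerivAt.deriv
  obtain ⟨F, hF, hFe⟩ := key
  obtain ⟨C, hC⟩ := hK.exists_bound_of_continuousOn (hF.continuousOn.mono hKU)
  refine ⟨max C 0, le_max_right _ _, fun p ξ h => ?_⟩
  rw [hFe p ξ (hKU h), ← Real.norm_eq_abs]
  exact (hC _ h).trans (le_max_left _ _)

theorem exists_contDiff_eq_on_nhds {f : ℝ → ℝ} {R r : ℝ} (hr : 0 < r) (hrR : r < R)
    (hf : ContDiffOn ℝ ∞ f (Set.Ioo (-R) R)) :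
    ∃ g : ℝ → ℝ, ContDiff ℝ ∞ g ∧ ∀ x ∈ Set.Icc (-r) r, g =ᶠ[𝓝 x] f := by
  let φ : ContDiffBump (0 : ℝ) := ⟨(2 * r + R) / 3, (r + 2 * R) / 3, by linarith, by linarith⟩
  refine ⟨fun x => φ x * f x, ?_, ?_⟩
  · rw [contDiff_iff_contDiffAt]
    intro x
    by_cases hx : x ∈ Set.Ioo (-R) R
    · exact φ.contDiff.contDiffAt.mul (hf.contDiffAt (isOpen_Ioo.mem_nhds hx))
    · have hx' : x ∉ tsupport φ := by
        rw [φ.tsupport_eq, Metric.mem_closedBall, Real.dist_eq, sub_zero]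
        intro h
        have h' : |x| ≤ (r + 2 * R) / 3 := h
        exact hx ⟨by linarith [neg_abs_le x], by linarith [le_abs_self x]⟩
      have h0 : (fun x => φ x * f x) =ᶠ[𝓝 x] fun _ => 0 := by
        filter_upwards [notMem_tsupport_iff_eventuallyEq.1 hx'] with y hy
        simp [hy]
      exact contDiffAt_const.congr_of_eventuallyEq h0
  · intro x hx
    have hmem : x ∈ Metric.ball (0 : ℝ) φ.rIn := by
      rw [Metric.mem_ball, Real.dist_eq, sub_zero, abs_lt]
      change -((2 * r + R) / 3) < x ∧ x < (2 * r + R) / 3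
      exact ⟨by linarith [hx.1], by linarith [hx.2]⟩
    filter_upwards [φ.eventuallyEq_one_of_mem_ball hmem] with y hy
    simp [hy]

theorem HasDerivAt.of_partial_derivs {F : ℝ × ℝ → ℝ} {g : ℝ → ℝ} {x A B g' : ℝ}
    (hF : DifferentiableAt ℝ F (x, g x)) (hA : HasDerivAt (fun s => F (s, g x)) A x)
    (hB : HasDerivAt (fun t => F (x, t)) B (g x)) (hg : HasDerivAt g g' x) :
    HasDerivAt (fun s => F (s, g s)) (A + B * g') x := by
  have h1 := hF.hasFDerivAt
  have hA' : fderiv ℝ F (x, g x) (1, 0) = A := by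
    have := (h1.comp x (hasFDerivAt_prodMk_left x (g x))).hasDerivAt.unique hA
    simpa using this
  have hB' : fderiv ℝ F (x, g x) (0, 1) = B := by
    have := (h1.comp (g x) (hasFDerivAt_prodMk_right x (g x))).hasDerivAt.unique hB
    simpa using this
  have h3 := h1.comp_hasDerivAt x ((hasDerivAt_id x).prodMk hg)
  have h4 : ((1 : ℝ), g') = (1, 0) + g' • ((0 : ℝ), (1 : ℝ)) := by simp
  rw [h4, map_add, map_smul, hA', hB', smul_eq_mul, mul_comm] at h3
  exact h3

/-- The coefficients, indexed by natural numbers, given by a finite array. -/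
def coeffOfArray (d : ℕ) (β : Fin (d + 1) → Fin (d + 1) → ℝ) (i j : ℕ) : ℝ :=
  β (Fin.ofNat (d + 1) i) (Fin.ofNat (d + 1) j)

theorem abs_coeffOfArray_le {d : ℕ} {β : Fin (d + 1) → Fin (d + 1) → ℝ} {δ : ℝ} (h : ‖β‖ ≤ δ)
    (i j : ℕ) : |coeffOfArray d β i j| ≤ δ :=
  ((norm_le_pi_norm _ _).trans (norm_le_pi_norm β _)).trans h

/-- The function `∂₁h - r ∂₂h`, jointly in the slope `r`, the coefficients of `h` and the two
variables. -/
def slopeEq (d : ℕ) (q : ((ℝ × (Fin (d + 1) → Fin (d + 1) → ℝ)) × ℝ) × ℝ) : ℝ :=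
  hpolyX d (coeffOfArray d q.1.1.2) q.1.2 q.2 -
    q.1.1.1 * hpolyY d (coeffOfArray d q.1.1.2) q.1.2 q.2

theorem contDiff_slopeEq (d : ℕ) : ContDiff ℝ ∞ (slopeEq d) := by
  unfold slopeEq hpolyX hpolyY coeffOfArray
  fun_prop

theorem hasDerivAt_slopeEq_snd {d : ℕ} (p : ℝ × (Fin (d + 1) → Fin (d + 1) → ℝ)) (ξ η : ℝ) :
    HasDerivAt (fun t => slopeEq d ((p, ξ), t))
      (hpolyXY d (coeffOfArray d p.2) ξ η - p.1 * hpolyYY d (coeffOfArray d p.2) ξ η) η := by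
  change HasDerivAt (fun t => hpolyX d (coeffOfArray d p.2) ξ t -
    p.1 * hpolyY d (coeffOfArray d p.2) ξ t) _ η
  exact (hasDerivAt_hpolyX_snd d (coeffOfArray d p.2) ξ η).fun_sub
    ((hasDerivAt_hpolyY_snd d (coeffOfArray d p.2) ξ η).const_mul p.1)

theorem hasDerivAt_slopeEq_fst {d : ℕ} (p : ℝ × (Fin (d + 1) → Fin (d + 1) → ℝ)) (ξ η : ℝ) :
    HasDerivAt (fun s => slopeEq d ((p, s), η))
      (hpolyXX d (coeffOfArray d p.2) ξ η - p.1 * hpolyXY d (coeffOfArray d p.2) ξ η) ξ := by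
  change HasDerivAt (fun s => hpolyX d (coeffOfArray d p.2) s η -
    p.1 * hpolyY d (coeffOfArray d p.2) s η) _ ξ
  exact (hasDerivAt_hpolyX_fst d (coeffOfArray d p.2) ξ η).fun_sub
    ((hasDerivAt_hpolyY_fst d (coeffOfArray d p.2) ξ η).const_mul p.1)

/-- A bound on the coefficients which makes the higher order part of `hpoly0` negligible. -/
def coeffRadius (d : ℕ) : ℝ := 1 / (1200 * (hpolyWeight d + 1))

theorem coeffRadius_pos (d : ℕ) : 0 < coeffRadius d := by
  have := hpolyWeight_nonneg d
  unfold coeffRadius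
  positivity

theorem coeffRadius_mul_le (d : ℕ) {t : ℝ} (ht : 0 ≤ t) :
    2 * coeffRadius d * (hpolyWeight d * t) ≤ t / 600 := by
  have := hpolyWeight_nonneg d
  unfold coeffRadius
  rw [mul_one_div, div_mul_eq_mul_div, div_le_iff₀ (by positivity)]
  nlinarith

/-- The parameters for which the zero set of `slopeEq` is controlled. -/
def slopeDomain (d : ℕ) : Set ((ℝ × (Fin (d + 1) → Fin (d + 1) → ℝ)) × ℝ) :=
  (Metric.ball 0 (21 / 20) ×ˢ Metric.ball 0 (2 * coeffRadius d)) ×ˢ Set.Ioo (-5) 5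

theorem isOpen_slopeDomain (d : ℕ) : IsOpen (slopeDomain d) :=
  (Metric.isOpen_ball.prod Metric.isOpen_ball).prod isOpen_Ioo

theorem slopeEq_deriv_pos {d : ℕ} {q : (ℝ × (Fin (d + 1) → Fin (d + 1) → ℝ)) × ℝ}
    (hq : q ∈ slopeDomain d) {η : ℝ} (hη : η ∈ Set.Icc (-6 : ℝ) 6) :
    0 < hpolyXY d (coeffOfArray d q.1.2) q.2 η -
      q.1.1 * hpolyYY d (coeffOfArray d q.1.2) q.2 η := by
  obtain ⟨⟨hr, hβ⟩, hξ⟩ := hq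
  rw [mem_ball_zero_iff, Real.norm_eq_abs] at hr
  rw [mem_ball_zero_iff] at hβ
  have hδ : 0 ≤ 2 * coeffRadius d := by linarith [coeffRadius_pos d]
  have hx : |q.2| ≤ 6 := abs_le.2 ⟨by linarith [hξ.1], by linarith [hξ.2]⟩
  have hw := coeffRadius_mul_le d (t := 6) (by norm_num)
  have h1 := abs_le.1 ((abs_hpolyXY_sub_le hδ (abs_coeffOfArray_le hβ.le) hx (abs_le.2 hη)
    le_rfl).trans hw)
  have h2 := (abs_hpolyYY_le hδ (abs_coeffOfArray_le hβ.le) hx (abs_le.2 hη)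
    le_rfl).trans hw
  have h3 := mul_le_mul hr.le h2 (abs_nonneg _) (by norm_num)
  rw [← abs_mul] at h3
  linarith [(abs_le.1 h3).2]

theorem slopeEq_sign {d : ℕ} {q : (ℝ × (Fin (d + 1) → Fin (d + 1) → ℝ)) × ℝ}
    (hq : q ∈ slopeDomain d) : slopeEq d (q, -6) < 0 ∧ 0 < slopeEq d (q, 6) := by
  obtain ⟨⟨hr, hβ⟩, hξ⟩ := hq
  rw [mem_ball_zero_iff, Real.norm_eq_abs] at hr
  rw [mem_ball_zero_iff] at hβ
  have hδ : 0 ≤ 2 * coeffRadius d := by linarith [coeffRadius_pos d]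
  have hx : |q.2| ≤ 6 := abs_le.2 ⟨by linarith [hξ.1], by linarith [hξ.2]⟩
  have hw := coeffRadius_mul_le d (t := 6) (by norm_num)
  have key : ∀ η : ℝ, |η| ≤ 6 → |slopeEq d (q, η) - η| < 6 := by
    intro η hη
    have h1 := abs_le.1
      ((abs_hpolyX_sub_le hδ (abs_coeffOfArray_le hβ.le) hx hη le_rfl).trans hw)
    have h2 := abs_le.1
      ((abs_hpolyY_sub_le hδ (abs_coeffOfArray_le hβ.le) hx hη le_rfl).trans hw)
    have h4 : |hpolyY d (coeffOfArray d q.1.2) q.2 η| ≤ 5 + 1 / 100 :=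
      abs_le.2 ⟨by linarith [hξ.1], by linarith [hξ.2]⟩
    have h3 := mul_le_mul hr.le h4 (abs_nonneg _) (by norm_num)
    rw [← abs_mul, abs_le] at h3
    rw [slopeEq, abs_lt]
    constructor <;> linarith [h3.1, h3.2]
  have hp := abs_lt.1 (key 6 (by norm_num))
  have hn := abs_lt.1 (key (-6) (by norm_num))
  exact ⟨by linarith [hn.2], by linarith [hp.1]⟩

theorem exists_slopeEq_graph (d : ℕ) :
    ∃ ψ : (ℝ × (Fin (d + 1) → Fin (d + 1) → ℝ)) × ℝ → ℝ, ContDiffOn ℝ ∞ ψ (slopeDomain d) ∧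
      ∀ q ∈ slopeDomain d, ψ q ∈ Set.Ioo (-6) 6 ∧
        ∀ η ∈ Set.Icc (-6) 6, slopeEq d (q, η) = 0 ↔ η = ψ q := by
  refine exists_contDiffOn_zero (contDiff_slopeEq d) (isOpen_slopeDomain d) (by norm_num)
    (fun q hq => (slopeEq_sign hq).1) (fun q hq => (slopeEq_sign hq).2) fun q hq η hη => ?_
  rw [(hasDerivAt_slopeEq_snd q.1 q.2 η).deriv]
  exact slopeEq_deriv_pos hq hη

theorem CoeffSmall0.exists_array {d : ℕ} {ε₀ : ℝ} {b : ℕ → ℕ → ℝ} (hb : CoeffSmall0 d ε₀ b) :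
    ∃ β : Fin (d + 1) → Fin (d + 1) → ℝ, ‖β‖ ≤ ε₀ ∧
      hpoly0 d b = hpoly0 d (coeffOfArray d β) := by
  have hS : 0 ≤ ∑ i ∈ Finset.Icc 3 d, ∑ j ∈ Finset.range (i + 1), |b i j| :=
    Finset.sum_nonneg fun _ _ => Finset.sum_nonneg fun _ _ => abs_nonneg _
  have hle : ∑ i ∈ Finset.Icc 3 d, ∑ j ∈ Finset.range (i + 1), |b i j| ≤ ε₀ :=
    (le_mul_of_one_le_left hS (one_le_pow₀ (by norm_num))).trans hb
  have h0 : 0 ≤ ε₀ := hS.trans hle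
  refine ⟨fun i j => if 3 ≤ (i : ℕ) ∧ (j : ℕ) ≤ i then b i j else 0, ?_, ?_⟩
  · refine (pi_norm_le_iff_of_nonneg h0).2 fun i => (pi_norm_le_iff_of_nonneg h0).2 fun j => ?_
    split_ifs with h
    · rw [Real.norm_eq_abs]
      refine le_trans ?_ hle
      refine le_trans ?_ (Finset.single_le_sum
        (f := fun i => ∑ j ∈ Finset.range (i + 1), |b i j|)
        (fun i _ => Finset.sum_nonneg fun _ _ => abs_nonneg _)
        (Finset.mem_Icc.2 ⟨h.1, Nat.lt_succ_iff.1 i.2⟩))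
      exact Finset.single_le_sum (f := fun j : ℕ => |b i j|) (fun _ _ => abs_nonneg _)
        (Finset.mem_range.2 (Nat.lt_succ_iff.2 h.2))
    · simpa using h0
  · funext ξ η
    unfold hpoly0
    congr 1
    refine Finset.sum_congr rfl fun i hi => Finset.sum_congr rfl fun j hj => ?_
    rw [Finset.mem_Icc] at hi
    rw [Finset.mem_range] at hj
    have h1 : i % (d + 1) = i := Nat.mod_eq_of_lt (by omega)
    have h2 : j % (d + 1) = j := Nat.mod_eq_of_lt (by omega)
    have h3 : 3 ≤ i ∧ j ≤ i := ⟨hi.1, by omega⟩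
    simp [coeffOfArray, h1, h2, h3]

theorem hpoly0_slope_bounds {d : ℕ} {b : ℕ → ℕ → ℝ} (hb : ∀ i j, |b i j| ≤ coeffRadius d)
    {x y : ℝ} (hx0 : x ≠ 0) (hx : |x| ≤ 2) (hy : |y| ≤ |x|) :
    hpolyY d b x y ≠ 0 ∧ |hpolyX d b x y / hpolyY d b x y| ≤ 103 / 100 := by
  have hδ := coeffRadius_pos d
  have hb' : ∀ i j, |b i j| ≤ 2 * coeffRadius d := fun i j => (hb i j).trans (by linarith)
  have hw := coeffRadius_mul_le d (abs_nonneg x)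
  have h1 := (abs_hpolyX_sub_le (by positivity) hb' le_rfl hy (by linarith)).trans hw
  have h2 := (abs_hpolyY_sub_le (by positivity) hb' le_rfl hy (by linarith)).trans hw
  have hpos := abs_pos.2 hx0
  have h3 := abs_sub_abs_le_abs_sub (hpolyX d b x y) y
  have h4 := abs_sub_abs_le_abs_sub x (hpolyY d b x y)
  rw [abs_sub_comm x] at h4
  have h5 : 0 < |hpolyY d b x y| := by linarith
  refine ⟨abs_pos.1 h5, ?_⟩
  rw [abs_div, div_le_iff₀ h5]
  linarith

theorem slopeEq_implicit_deriv {d : ℕ} {p : ℝ × (Fin (d + 1) → Fin (d + 1) → ℝ)} {g : ℝ → ℝ}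
    {ξ : ℝ} (hp : (p, ξ) ∈ slopeDomain d) (hξ : g ξ ∈ Set.Icc (-6 : ℝ) 6)
    (hg : DifferentiableAt ℝ g ξ) (h0 : ∀ᶠ s in 𝓝 ξ, slopeEq d ((p, s), g s) = 0) :
    deriv g ξ = (p.1 * hpolyXY d (coeffOfArray d p.2) ξ (g ξ) -
        hpolyXX d (coeffOfArray d p.2) ξ (g ξ)) /
      (hpolyXY d (coeffOfArray d p.2) ξ (g ξ) - p.1 * hpolyYY d (coeffOfArray d p.2) ξ (g ξ)) := by
  have hQ : ContDiff ℝ ∞ fun v : ℝ × ℝ => slopeEq d ((p, v.1), v.2) :=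
    (contDiff_slopeEq d).comp (by fun_prop)
  have h1 := HasDerivAt.of_partial_derivs (hQ.differentiable (by simp) (ξ, g ξ))
    (hasDerivAt_slopeEq_fst p ξ (g ξ)) (hasDerivAt_slopeEq_snd p ξ (g ξ)) hg.hasDerivAt
  have h2 := h1.unique ((hasDerivAt_const ξ (0 : ℝ)).congr_of_eventuallyEq h0)
  rw [eq_div_iff (slopeEq_deriv_pos hp hξ).ne']
  linarith

/-- the zero set of `P` in `[-4,4]²` is a graph `η = η₀(ξ)` of a smooth
function with `η₀(0) = 0`, the explicit formula for `η₀'`, `η₀'(0) = ∂₁h₀(ζ̄)/∂₂h₀(ζ̄)`,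
and bounds `|η₀^{(j)}| ≤ C_d` for `1 ≤ j ≤ d`. -/
theorem statement11 (d : ℕ) (hd : 3 ≤ d) :
    ∃ Cd : ℝ, 0 < Cd ∧ ∃ ε₀' > (0 : ℝ), ∀ ε₀ : ℝ, 0 < ε₀ → ε₀ ≤ ε₀' →
      ∃ K₀ : ℝ, ∀ KL : ℝ, K₀ ≤ KL →
        ∀ b : ℕ → ℕ → ℝ, CoeffSmall0 d ε₀ b →
          ∀ z : ℝ × ℝ, z ∈ Set.Icc (-2 : ℝ) 2 ×ˢ Set.Icc (-2 : ℝ) 2 →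
            (2 * KL)⁻¹ < Real.sqrt (z.1 ^ 2 + z.2 ^ 2) →
            |z.2| ≤ |z.1| →
            ∀ P : ℝ → ℝ → ℝ,
              P = (fun x y =>
                pd1 (hpoly0 d b) x y * pd2 (hpoly0 d b) z.1 z.2 -
                  pd2 (hpoly0 d b) x y * pd1 (hpoly0 d b) z.1 z.2) →
              ∃ η₀ : ℝ → ℝ, ContDiff ℝ (⊤ : ℕ∞) η₀ ∧ η₀ 0 = 0 ∧
                ({p : ℝ × ℝ | P p.1 p.2 = 0} ∩
                    (Set.Icc (-4 : ℝ) 4 ×ˢ Set.Icc (-4 : ℝ) 4) =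
                  {p : ℝ × ℝ | ∃ ξ ∈ Set.Icc (-4 : ℝ) 4, p = (ξ, η₀ ξ)} ∩
                    (Set.Icc (-4 : ℝ) 4 ×ˢ Set.Icc (-4 : ℝ) 4)) ∧
                (∀ ξ ∈ Set.Icc (-4 : ℝ) 4,
                  (pd12 (hpoly0 d b) ξ (η₀ ξ) * pd2 (hpoly0 d b) z.1 z.2 -
                      pd22 (hpoly0 d b) ξ (η₀ ξ) * pd1 (hpoly0 d b) z.1 z.2) ≠ 0 ∧
                  deriv η₀ ξ =
                    (pd12 (hpoly0 d b) ξ (η₀ ξ) * pd1 (hpoly0 d b) z.1 z.2 -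
                        pd11 (hpoly0 d b) ξ (η₀ ξ) * pd2 (hpoly0 d b) z.1 z.2) /
                      (pd12 (hpoly0 d b) ξ (η₀ ξ) * pd2 (hpoly0 d b) z.1 z.2 -
                        pd22 (hpoly0 d b) ξ (η₀ ξ) * pd1 (hpoly0 d b) z.1 z.2)) ∧
                deriv η₀ 0 = pd1 (hpoly0 d b) z.1 z.2 / pd2 (hpoly0 d b) z.1 z.2 ∧
                ∀ j : ℕ, 1 ≤ j → j ≤ d →
                  ∀ ξ ∈ Set.Icc (-4 : ℝ) 4, |iteratedDeriv j η₀ ξ| ≤ Cd := by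
  obtain ⟨ψ, hψ, hψg⟩ := exists_slopeEq_graph d
  let K : Set ((ℝ × (Fin (d + 1) → Fin (d + 1) → ℝ)) × ℝ) :=
    (Metric.closedBall 0 (103 / 100) ×ˢ Metric.closedBall 0 (coeffRadius d)) ×ˢ Set.Icc (-4) 4
  have hK : IsCompact K :=
    ((isCompact_closedBall _ _).prod (isCompact_closedBall _ _)).prod isCompact_Icc
  have hδ := coeffRadius_pos d
  have hKU : K ⊆ slopeDomain d :=
    Set.prod_mono (Set.prod_mono (Metric.closedBall_subset_ball (by norm_num))
      (Metric.closedBall_subset_ball (by linarith)))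
    (Set.Icc_subset_Ioo (by norm_num) (by norm_num))
  choose C hC0 hC using exists_bound_iteratedDeriv_snd (isOpen_slopeDomain d) hK hKU hψ
  refine ⟨1 + ∑ j ∈ Finset.range (d + 1), C j,
    add_pos_of_pos_of_nonneg one_pos (Finset.sum_nonneg fun j _ => hC0 j), coeffRadius d, hδ, ?_⟩
  intro ε₀ _ hε₀
  refine ⟨1, fun KL hKL b hb z hz hzn hzz P hP => ?_⟩
  obtain ⟨β, hβ, hbβ⟩ := hb.exists_array
  replace hβ : ‖β‖ ≤ coeffRadius d := hβ.trans hε₀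
  simp only [hbβ, pd1_hpoly0, pd2_hpoly0, pd11_hpoly0, pd12_hpoly0, pd22_hpoly0] at hP ⊢
  have hz1 : z.1 ≠ 0 := by
    intro h
    have h2 : z.2 = 0 := by simpa [h] using hzz
    rw [h, h2] at hzn
    have : 0 < (2 * KL)⁻¹ := by positivity
    simp only [ne_eq, OfNat.ofNat_ne_zero, not_false_eq_true, zero_pow, add_zero,
      Real.sqrt_zero] at hzn
    exact lt_asymm this hzn
  obtain ⟨hc, hr⟩ := hpoly0_slope_bounds (abs_coeffOfArray_le hβ) hz1 (abs_le.2 hz.1) hzz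
  set a := hpolyX d (coeffOfArray d β) z.1 z.2
  set c := hpolyY d (coeffOfArray d β) z.1 z.2
  set p : ℝ × (Fin (d + 1) → Fin (d + 1) → ℝ) := (a / c, β) with hp
  have hpK : ∀ ξ ∈ Set.Icc (-4 : ℝ) 4, (p, ξ) ∈ K := fun ξ hξ =>
    ⟨⟨mem_closedBall_zero_iff.2 hr, mem_closedBall_zero_iff.2 hβ⟩, hξ⟩
  have hpU : ∀ ξ ∈ Set.Ioo (-5 : ℝ) 5, (p, ξ) ∈ slopeDomain d := fun ξ hξ =>
    ⟨(hKU (hpK 0 (by norm_num))).1, hξ⟩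
  have hPQ : ∀ x y, P x y = c * slopeEq d ((p, x), y) := by
    intro x y
    simp only [hP, slopeEq, hp]
    field_simp
  obtain ⟨g, hg, hgψ⟩ := exists_contDiff_eq_on_nhds (f := fun s => ψ (p, s)) (R := 5) (r := 4)
    (by norm_num) (by norm_num) (hψ.comp (by fun_prop) hpU)
  have hgψ' : ∀ ξ ∈ Set.Icc (-4 : ℝ) 4, g ξ = ψ (p, ξ) := fun ξ hξ => (hgψ ξ hξ).eq_of_nhds
  have hsub : Set.Icc (-4 : ℝ) 4 ⊆ Set.Ioo (-5) 5 :=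
    Set.Icc_subset_Ioo (by norm_num) (by norm_num)
  have hg6 : ∀ ξ ∈ Set.Icc (-4 : ℝ) 4, g ξ ∈ Set.Icc (-6 : ℝ) 6 := fun ξ hξ => by
    rw [hgψ' ξ hξ]
    exact Set.Ioo_subset_Icc_self (hψg _ (hpU ξ (hsub hξ))).1
  have hzero : ∀ ξ ∈ Set.Icc (-4 : ℝ) 4, ∀ η ∈ Set.Icc (-6 : ℝ) 6, P ξ η = 0 ↔ η = g ξ := by
    intro ξ hξ η hη
    rw [hPQ, mul_eq_zero, or_iff_right hc, hgψ' ξ hξ]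
    exact (hψg _ (hpU ξ (hsub hξ))).2 η hη
  have hX0 : hpolyX d (coeffOfArray d β) 0 0 = 0 := by
    have h := abs_hpolyX_sub_le (norm_nonneg β) (abs_coeffOfArray_le le_rfl) (d := d) (t := 0)
      abs_zero.le abs_zero.le (by norm_num)
    simpa using h
  have hY0 : hpolyY d (coeffOfArray d β) 0 0 = 0 := by
    have h := abs_hpolyY_sub_le (norm_nonneg β) (abs_coeffOfArray_le le_rfl) (d := d) (t := 0)
      abs_zero.le abs_zero.le (by norm_num)
    simpa using h
  have hXX0 : hpolyXX d (coeffOfArray d β) 0 0 = 0 := by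
    have h := abs_hpolyXX_le (norm_nonneg β) (abs_coeffOfArray_le le_rfl) (d := d) (t := 0)
      abs_zero.le abs_zero.le (by norm_num)
    simpa using h
  have hYY0 : hpolyYY d (coeffOfArray d β) 0 0 = 0 := by
    have h := abs_hpolyYY_le (norm_nonneg β) (abs_coeffOfArray_le le_rfl) (d := d) (t := 0)
      abs_zero.le abs_zero.le (by norm_num)
    simpa using h
  have hXY0 : hpolyXY d (coeffOfArray d β) 0 0 = 1 := by
    have h := abs_hpolyXY_sub_le (norm_nonneg β) (abs_coeffOfArray_le le_rfl) (d := d) (t := 0)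
      abs_zero.le abs_zero.le (by norm_num)
    simpa [sub_eq_zero] using h
  have h00 : (0 : ℝ) ∈ Set.Icc (-4 : ℝ) 4 := by norm_num
  have hg0 : g 0 = 0 :=
    ((hzero 0 h00 0 (by norm_num)).1 (by rw [hP]; simp [hX0, hY0])).symm
  have hden : ∀ ξ ∈ Set.Icc (-4 : ℝ) 4, hpolyXY d (coeffOfArray d β) ξ (g ξ) * c -
      hpolyYY d (coeffOfArray d β) ξ (g ξ) * a ≠ 0 ∧ deriv g ξ =
        (hpolyXY d (coeffOfArray d β) ξ (g ξ) * a - hpolyXX d (coeffOfArray d β) ξ (g ξ) * c) /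
        (hpolyXY d (coeffOfArray d β) ξ (g ξ) * c -
          hpolyYY d (coeffOfArray d β) ξ (g ξ) * a) := by
    intro ξ hξ
    have hpos := slopeEq_deriv_pos (hpU ξ (hsub hξ)) (hg6 ξ hξ)
    have hev : ∀ᶠ s in 𝓝 ξ, slopeEq d ((p, s), g s) = 0 := by
      filter_upwards [hgψ ξ hξ, isOpen_Ioo.mem_nhds (hsub hξ)] with s hs hs5
      have h := hψg _ (hpU s hs5)
      exact (h.2 _ (hs ▸ Set.Ioo_subset_Icc_self h.1)).2 hs
    have hd := slopeEq_implicit_deriv (hpU ξ (hsub hξ)) (hg6 ξ hξ)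
      (hg.differentiable (by simp) ξ) hev
    have hfac : hpolyXY d (coeffOfArray d β) ξ (g ξ) * c -
        hpolyYY d (coeffOfArray d β) ξ (g ξ) * a = c * (hpolyXY d (coeffOfArray d β) ξ (g ξ) -
          a / c * hpolyYY d (coeffOfArray d β) ξ (g ξ)) := by
      field_simp
    have hnum : hpolyXY d (coeffOfArray d β) ξ (g ξ) * a -
        hpolyXX d (coeffOfArray d β) ξ (g ξ) * c =
          c * (a / c * hpolyXY d (coeffOfArray d β) ξ (g ξ) -
            hpolyXX d (coeffOfArray d β) ξ (g ξ)) := by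
      field_simp
    rw [hfac, hnum, mul_div_mul_left _ _ hc]
    exact ⟨mul_ne_zero hc hpos.ne', hd⟩
  refine ⟨g, hg, hg0, ?_, hden, ?_, ?_⟩
  · ext ⟨x, y⟩
    constructor
    · rintro ⟨h, hx, hy⟩
      refine ⟨⟨x, hx, ?_⟩, hx, hy⟩
      rw [(hzero x hx y ⟨by linarith [hy.1], by linarith [hy.2]⟩).1 h]
    · rintro ⟨⟨ξ, hξ, h⟩, hx, hy⟩
      obtain ⟨rfl, rfl⟩ := Prod.mk.inj h
      exact ⟨(hzero x hξ _ (hg6 x hξ)).2 rfl, hx, hy⟩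
  · rw [(hden 0 h00).2, hg0, hXX0, hYY0, hXY0]
    simp
  · intro j _ hj ξ hξ
    rw [(hgψ ξ hξ).iteratedDeriv_eq j]
    refine (hC j p ξ (hpK ξ hξ)).trans ?_
    have := Finset.single_le_sum (f := C) (fun i _ => hC0 i)
      (Finset.mem_range.2 (Nat.lt_succ_iff.2 hj))
    linarith
end
end
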